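/- (Three-term recurrence for q_l^m.) For every integer l ≥ m and every real ν with |ν| > 1, √((l+1)² − m²) q_{l+1}^m(ν) = (2l+1) ν q_l^m(ν) − √(l² − m²) q_{l−1}^m(ν) − δ_{l,m} · √((2m)!)/(2m−1)!!, where δ_{l,m} is the Kronecker delta and (2m−1)!! = (2m)!/(2^m m!), so that √((2m)!)/(2m−1)!! = 2^m m!/√((2m)!). -/

import Mathlib

open MeasureTheory Filter

/-- Legendre polynomial via Rodrigues' formula. -/
noncomputable def legendreP (l : ℕ) (x : ℝ) : ℝ :=
  (1 / (2 ^ l * (Nat.factorial l : ℝ))) *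
    iteratedDeriv l (fun y : ℝ => (y ^ 2 - 1) ^ l) x

/-- `p_l^m(μ) = √((l−m)!/(l+m)!) (d/dμ)^m P_l(μ)`; it vanishes for `l < m`
(in particular the convention `p_{m−1}^m = 0` holds). -/
noncomputable def pml (m l : ℕ) (μ : ℝ) : ℝ :=
  Real.sqrt ((Nat.factorial (l - m) : ℝ) / (Nat.factorial (l + m) : ℝ)) *
    iteratedDeriv m (legendreP l) μ

/-- `q_l^m(w) = (1/2) ∫_{−1}^{1} p_l^m(μ)/(w−μ) (1−μ²)^m dμ`. -/
noncomputable def qml (m l : ℕ) (w : ℝ) : ℝ :=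
  (1 / 2) * ∫ μ in (-1 : ℝ)..1, pml m l μ / (w - μ) * (1 - μ ^ 2) ^ m

/-- `h_l = 2l+1 − ϖ β_l` for `l ≤ L`, and `h_l = 2l+1` for `l > L`. -/
noncomputable def hcoef (ϖ : ℝ) (β : ℕ → ℝ) (L l : ℕ) : ℝ :=
  if l ≤ L then 2 * l + 1 - ϖ * β l else 2 * l + 1

/-- Auxiliary recursion: `chandraAux ϖ β L m ν n = g_{m+n}^m(ν)`, built from the
initial value `g_m^m(ν) = √((2m)!)/(2^m m!)`, the convention `g_{m−1}^m = 0`, and the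
three-term recurrence `ν h_l g_l^m = √((l+1)²−m²) g_{l+1}^m + √(l²−m²) g_{l−1}^m`. -/
noncomputable def chandraAux (ϖ : ℝ) (β : ℕ → ℝ) (L m : ℕ) (ν : ℝ) : ℕ → ℝ
  | 0 => Real.sqrt (Nat.factorial (2 * m)) / (2 ^ m * Nat.factorial m)
  | 1 => ν * hcoef ϖ β L m *
      (Real.sqrt (Nat.factorial (2 * m)) / (2 ^ m * Nat.factorial m)) /
      Real.sqrt (((m : ℝ) + 1) ^ 2 - (m : ℝ) ^ 2)
  | n + 2 =>
      (ν * hcoef ϖ β L (m + n + 1) * chandraAux ϖ β L m ν (n + 1) -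
          Real.sqrt (((m + n + 1 : ℕ) : ℝ) ^ 2 - (m : ℝ) ^ 2) * chandraAux ϖ β L m ν n) /
        Real.sqrt (((m + n + 2 : ℕ) : ℝ) ^ 2 - (m : ℝ) ^ 2)

/-- The normalized Chandrasekhar polynomial `g_l^m(ν)` (with value `0` for `l < m`). -/
noncomputable def gml (ϖ : ℝ) (β : ℕ → ℝ) (L m l : ℕ) (ν : ℝ) : ℝ :=
  if l < m then 0 else chandraAux ϖ β L m ν (l - m)

/-- `g^m(ν,μ) = Σ_{l=m}^{L} β_l p_l^m(μ) g_l^m(ν)`. -/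
noncomputable def gfun (ϖ : ℝ) (β : ℕ → ℝ) (L m : ℕ) (ν μ : ℝ) : ℝ :=
  ∑ l ∈ Finset.Icc m L, β l * pml m l μ * gml ϖ β L m l ν

/-- `Λ^m(w) = 1 − (ϖ w/2) ∫_{−1}^{1} g^m(w,μ)/(w−μ) (1−μ²)^m dμ`. -/
noncomputable def Lam (ϖ : ℝ) (β : ℕ → ℝ) (L m : ℕ) (w : ℝ) : ℝ :=
  1 - ϖ * w / 2 * ∫ μ in (-1 : ℝ)..1, gfun ϖ β L m w μ / (w - μ) * (1 - μ ^ 2) ^ m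

/-- The off-diagonal entry `b_l = √((l²−m²)/(h_l h_{l−1}))`. -/
noncomputable def bcoef (ϖ : ℝ) (β : ℕ → ℝ) (L m l : ℕ) : ℝ :=
  Real.sqrt (((l : ℝ) ^ 2 - (m : ℝ) ^ 2) / (hcoef ϖ β L l * hcoef ϖ β L (l - 1)))

/-- The symmetric tridiagonal matrix `B(m)` with rows/columns indexed by
`l ∈ {m, …, l_B}` (here `l = m + i` for `i : Fin (l_B − m + 1)`), zero diagonal and
off-diagonal entries `B(m)_{l,l−1} = B(m)_{l−1,l} = b_l`. -/
noncomputable def Bmat (ϖ : ℝ) (β : ℕ → ℝ) (L m lB : ℕ) :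
    Matrix (Fin (lB - m + 1)) (Fin (lB - m + 1)) ℝ :=
  fun i j =>
    if (i : ℕ) + 1 = (j : ℕ) then bcoef ϖ β L m (m + j)
    else if (j : ℕ) + 1 = (i : ℕ) then bcoef ϖ β L m (m + i)
    else 0

section RodriguesPolynomial

open Polynomial

theorem iteratedDeriv_polynomial_eval (p : ℝ[X]) (n : ℕ) :
    iteratedDeriv n (fun x => p.eval x) = fun x => (derivative^[n] p).eval x := by
  induction n with
  | zero => simp
  | succ n ih =>
    rw [iteratedDeriv_succ, ih, Function.iterate_succ_apply']
    ext x
    exact Polynomial.deriv _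

/-- The `(l + m)`-th derivative of `(X² - 1)^l`. -/
noncomputable def rodrigues (m l : ℕ) : ℝ[X] :=
  derivative^[l + m] ((X ^ 2 - 1) ^ l)

theorem iteratedDeriv_legendreP (m l : ℕ) (x : ℝ) :
    iteratedDeriv m (legendreP l) x =
      1 / (2 ^ l * (Nat.factorial l : ℝ)) * (rodrigues m l).eval x := by
  have h : legendreP l = fun x =>
      (C (1 / (2 ^ l * (Nat.factorial l : ℝ))) *
        derivative^[l] ((X ^ 2 - 1 : ℝ[X]) ^ l)).eval x := by
    ext x
    have := congrFun (iteratedDeriv_polynomial_eval ((X ^ 2 - 1 : ℝ[X]) ^ l) l) x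
    simp only [eval_pow, eval_sub, eval_X, eval_one] at this
    rw [legendreP, this, eval_mul, eval_C]
  rw [h, iteratedDeriv_polynomial_eval, iterate_derivative_C_mul]
  simp only [eval_mul, eval_C]
  rw [rodrigues, ← Function.iterate_add_apply, Nat.add_comm]

theorem natDegree_X_sq_sub_one_pow (l : ℕ) : ((X ^ 2 - 1 : ℝ[X]) ^ l).natDegree = 2 * l := by
  have h : (X ^ 2 - 1 : ℝ[X]).natDegree = 2 := by compute_degree!
  rw [natDegree_pow, h, Nat.mul_comm]

theorem rodrigues_eq_zero {m l : ℕ} (h : l < m) : rodrigues m l = 0 :=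
  iterate_derivative_eq_zero (by rw [natDegree_X_sq_sub_one_pow]; omega)

theorem rodrigues_self (m : ℕ) : rodrigues m m = C (Nat.factorial (2 * m) : ℝ) := by
  have hd := natDegree_X_sq_sub_one_pow m
  have hmonic : ((X ^ 2 - 1 : ℝ[X]) ^ m).Monic := by
    have : (X ^ 2 - 1 : ℝ[X]).Monic := by monicity!
    exact this.pow m
  have h0 : (rodrigues m m).natDegree ≤ 0 := by
    refine (natDegree_iterate_derivative _ _).trans ?_
    rw [hd]; omega
  rw [eq_C_of_natDegree_le_zero h0, rodrigues, coeff_iterate_derivative, ← two_mul, zero_add,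
    Nat.descFactorial_self]
  have hc : ((X ^ 2 - 1 : ℝ[X]) ^ m).coeff (2 * m) = 1 := by
    rw [← hd]; exact hmonic
  rw [hc]; simp

theorem iterate_derivative_X_mul_succ (f : ℝ[X]) (n : ℕ) :
    derivative^[n + 1] (X * f) =
      X * derivative^[n + 1] f + ((n + 1 : ℕ) : ℝ[X]) * derivative^[n] f := by
  induction n with
  | zero => simp [derivative_mul, add_comm]
  | succ n ih =>
    rw [Function.iterate_succ_apply', ih, derivative_add, derivative_mul, derivative_natCast_mul,
      derivative_X, ← Function.iterate_succ_apply' derivative (n + 1) f,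
      ← Function.iterate_succ_apply' derivative n f]
    push_cast
    ring

theorem derivative_X_sq_sub_one_pow_succ (k : ℕ) :
    derivative ((X ^ 2 - 1 : ℝ[X]) ^ (k + 1)) =
      ((2 * (k + 1) : ℕ) : ℝ[X]) * (X * (X ^ 2 - 1) ^ k) := by
  simp only [derivative_pow_succ, derivative_sub, derivative_X, derivative_one, C_add, map_one,
    map_natCast]
  push_cast
  ring

theorem rodrigues_recurrence (m l : ℕ) :
    ((l : ℝ[X]) + 2 - (m : ℝ[X])) * rodrigues m (l + 2) =
      2 * ((l : ℝ[X]) + 2) * (2 * (l : ℝ[X]) + 3) * (X * rodrigues m (l + 1)) -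
        4 * ((l : ℝ[X]) + 1) * ((l : ℝ[X]) + 2) * ((l : ℝ[X]) + 1 + (m : ℝ[X])) *
          rodrigues m l := by
  have e : l + 2 + m = (l + m + 1) + 1 := by ring
  have e' : l + 1 + m = l + m + 1 := by ring
  have h1 : rodrigues m (l + 2) = 2 * ((l : ℝ[X]) + 2) * (X * rodrigues m (l + 1) +
      ((l : ℝ[X]) + 1 + (m : ℝ[X])) * derivative^[l + m] ((X ^ 2 - 1) ^ (l + 1))) := by
    rw [rodrigues, rodrigues, e, e', Function.iterate_succ_apply,
      derivative_X_sq_sub_one_pow_succ, iterate_derivative_natCast_mul,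
      iterate_derivative_X_mul_succ]
    push_cast
    ring
  have h2 : rodrigues m (l + 2) =
      2 * ((l : ℝ[X]) + 2) * (2 * (l : ℝ[X]) + 3) * derivative^[l + m] ((X ^ 2 - 1) ^ (l + 1)) +
        4 * ((l : ℝ[X]) + 1) * ((l : ℝ[X]) + 2) * rodrigues m l := by
    have hd2 : derivative (derivative ((X ^ 2 - 1 : ℝ[X]) ^ (l + 2))) =
        ((2 * (l + 2) * (2 * l + 3) : ℕ) : ℝ[X]) * (X ^ 2 - 1) ^ (l + 1) +
          ((4 * (l + 1) * (l + 2) : ℕ) : ℝ[X]) * (X ^ 2 - 1) ^ l := by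
      rw [derivative_X_sq_sub_one_pow_succ (l + 1), derivative_natCast_mul, derivative_mul,
        derivative_X_sq_sub_one_pow_succ l, derivative_X]
      push_cast
      ring
    rw [rodrigues, rodrigues, e, Function.iterate_succ_apply, Function.iterate_succ_apply, hd2,
      iterate_map_add, iterate_derivative_natCast_mul, iterate_derivative_natCast_mul]
    push_cast
    ring
  linear_combination (2 * (l : ℝ[X]) + 3) * h1 - ((l : ℝ[X]) + 1 + (m : ℝ[X])) * h2

theorem intervalIntegrable_eval (p : ℝ[X]) (a b : ℝ) :
    IntervalIntegrable (fun x => p.eval x) volume a b :=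
  p.continuous.intervalIntegrable a b

theorem integral_iterate_derivative_mul (f g : ℝ[X]) {a b : ℝ} (n : ℕ)
    (ha : ∀ i < n, (derivative^[i] g).eval a = 0) (hb : ∀ i < n, (derivative^[i] g).eval b = 0) :
    ∫ x in a..b, (derivative^[n] f).eval x * g.eval x =
      (-1) ^ n * ∫ x in a..b, f.eval x * (derivative^[n] g).eval x := by
  induction n generalizing f with
  | zero => simp
  | succ n ih =>
    rw [Function.iterate_succ_apply,
      ih _ (fun i hi => ha i (by omega)) (fun i hi => hb i (by omega)),
      Function.iterate_succ_apply']
    have h := intervalIntegral.integral_deriv_mul_eq_sub (a := a) (b := b)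
      (fun x _ => f.hasDerivAt x) (fun x _ => (derivative^[n] g).hasDerivAt x)
      (intervalIntegrable_eval _ _ _) (intervalIntegrable_eval _ _ _)
    rw [ha n (by omega), hb n (by omega), intervalIntegral.integral_add
      (by simpa using intervalIntegrable_eval (derivative f * derivative^[n] g) a b)
      (by simpa using intervalIntegrable_eval (f * derivative (derivative^[n] g)) a b)] at h
    rw [pow_succ]
    linear_combination (-1 : ℝ) ^ n * h

theorem eval_iterate_derivative_X_sq_sub_one_pow {l i : ℕ} (h : i < l) {x : ℝ} (hx : x ^ 2 = 1) :
    (derivative^[i] ((X ^ 2 - 1 : ℝ[X]) ^ l)).eval x = 0 := by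
  obtain ⟨q, hq⟩ := pow_sub_dvd_iterate_derivative_pow (X ^ 2 - 1 : ℝ[X]) l i
  rw [hq]
  simp [hx, Nat.sub_ne_zero_of_lt h]

theorem integral_rodrigues_mul_eq_zero {m l : ℕ} (h : m < l) :
    ∫ x in (-1 : ℝ)..1, (rodrigues m l).eval x * (1 - x ^ 2) ^ m = 0 := by
  have hv (k : ℕ) : ∀ i < k, ∀ x : ℝ, x ^ 2 = 1 →
      (derivative^[i] ((X ^ 2 - 1 : ℝ[X]) ^ k)).eval x = 0 :=
    fun i hi x hx => eval_iterate_derivative_X_sq_sub_one_pow hi hx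
  have h1 := integral_iterate_derivative_mul (a := -1) (b := 1)
    (derivative^[l] ((X ^ 2 - 1 : ℝ[X]) ^ l)) ((X ^ 2 - 1) ^ m) m
    (fun i hi => hv m i hi _ (by norm_num)) (fun i hi => hv m i hi _ (by norm_num))
  have h2 := integral_iterate_derivative_mul (a := -1) (b := 1)
    (derivative^[m] ((X ^ 2 - 1 : ℝ[X]) ^ m)) ((X ^ 2 - 1) ^ l) l
    (fun i hi => hv l i hi _ (by norm_num)) (fun i hi => hv l i hi _ (by norm_num))
  have h3 : derivative^[l] (derivative^[m] ((X ^ 2 - 1 : ℝ[X]) ^ m)) = 0 := by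
    rw [← Function.iterate_add_apply]
    exact iterate_derivative_eq_zero (by rw [natDegree_X_sq_sub_one_pow]; omega)
  simp only [h3, eval_zero, zero_mul, intervalIntegral.integral_zero] at h2
  have h4 : ∫ x in (-1 : ℝ)..1, (derivative^[l] ((X ^ 2 - 1 : ℝ[X]) ^ l)).eval x *
      (derivative^[m] ((X ^ 2 - 1 : ℝ[X]) ^ m)).eval x = 0 := by
    have := (mul_eq_zero.mp h2.symm).resolve_left (by simp)
    simpa only [mul_comm] using this
  rw [h4, mul_zero, ← Function.iterate_add_apply, Nat.add_comm m l] at h1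
  have h5 (x : ℝ) : (rodrigues m l).eval x * (1 - x ^ 2) ^ m =
      (-1) ^ m * ((derivative^[l + m] ((X ^ 2 - 1 : ℝ[X]) ^ l)).eval x *
        ((X ^ 2 - 1 : ℝ[X]) ^ m).eval x) := by
    rw [show (1 - x ^ 2) = (-1) * (x ^ 2 - 1) by ring, mul_pow, rodrigues]
    simp only [eval_pow, eval_sub, eval_X, eval_one]
    ring
  simp only [h5, intervalIntegral.integral_const_mul, h1, mul_zero]

end RodriguesPolynomial

theorem integral_one_sub_sq_pow (m : ℕ) :
    ∫ x in (-1 : ℝ)..1, (1 - x ^ 2) ^ m =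
      2 * (2 ^ m * (Nat.factorial m : ℝ)) ^ 2 / (Nat.factorial (2 * m + 1) : ℝ) := by
  induction m with
  | zero => norm_num
  | succ m ih =>
    have hd (x : ℝ) : HasDerivAt (fun x : ℝ => x * (1 - x ^ 2) ^ (m + 1))
        ((2 * m + 3) * (1 - x ^ 2) ^ (m + 1) - 2 * (m + 1) * (1 - x ^ 2) ^ m) x := by
      have := (hasDerivAt_id x).mul ((((hasDerivAt_id x).pow 2).const_sub 1).pow (m + 1))
      refine this.congr_deriv ?_
      simp
      ring
    have h := intervalIntegral.integral_eq_sub_of_hasDerivAt (a := -1) (b := 1)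
      (fun x _ => hd x) (Continuous.intervalIntegrable (by fun_prop) _ _)
    rw [intervalIntegral.integral_sub (Continuous.intervalIntegrable (by fun_prop) _ _)
      (Continuous.intervalIntegrable (by fun_prop) _ _), intervalIntegral.integral_const_mul,
      intervalIntegral.integral_const_mul, ih] at h
    have h' : ∫ x in (-1 : ℝ)..1, (1 - x ^ 2) ^ (m + 1) = 2 * (m + 1) / (2 * m + 3) *
        (2 * (2 ^ m * (Nat.factorial m : ℝ)) ^ 2 / (Nat.factorial (2 * m + 1) : ℝ)) := by
      rw [div_mul_eq_mul_div, eq_div_iff (by positivity)]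
      norm_num at h
      linear_combination h
    rw [h', show 2 * (m + 1) + 1 = (2 * m + 1) + 1 + 1 by ring, Nat.factorial_succ (2 * m + 1 + 1),
      Nat.factorial_succ (2 * m + 1), Nat.factorial_succ m]
    push_cast
    field_simp
    ring

theorem pml_eq (m l : ℕ) (x : ℝ) :
    pml m l x = Real.sqrt ((Nat.factorial (l - m) : ℝ) / (Nat.factorial (l + m) : ℝ)) *
      (1 / (2 ^ l * (Nat.factorial l : ℝ)) * (rodrigues m l).eval x) := by
  rw [pml, iteratedDeriv_legendreP]

theorem continuous_pml (m l : ℕ) : Continuous (pml m l) := by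
  have h : pml m l = fun x => _ := funext (pml_eq m l)
  rw [h]
  fun_prop

theorem sqrt_mul_sqrt_factorial_ratio_succ (m k : ℕ) :
    Real.sqrt (((m + k : ℕ) + 1 : ℝ) ^ 2 - (m : ℝ) ^ 2) *
        Real.sqrt ((Nat.factorial (k + 1) : ℝ) / (Nat.factorial (m + k + 1 + m) : ℝ)) =
      (k + 1) * Real.sqrt ((Nat.factorial k : ℝ) / (Nat.factorial (m + k + m) : ℝ)) := by
  have h0 : (0 : ℝ) ≤ ((m + k : ℕ) + 1 : ℝ) ^ 2 - (m : ℝ) ^ 2 := by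
    push_cast
    nlinarith [Nat.cast_nonneg (α := ℝ) m, Nat.cast_nonneg (α := ℝ) k]
  rw [← Real.sqrt_mul h0]
  rw [← Real.sqrt_sq (by positivity : (0 : ℝ) ≤ k + 1), ← Real.sqrt_mul (by positivity)]
  congr 1
  rw [show m + k + 1 + m = m + k + m + 1 by ring, Nat.factorial_succ k,
    Nat.factorial_succ (m + k + m)]
  push_cast
  field_simp
  ring

theorem sqrt_mul_sqrt_factorial_ratio_pred (m k : ℕ) :
    Real.sqrt (((m + k : ℕ) + 1 : ℝ) ^ 2 - (m : ℝ) ^ 2) *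
        Real.sqrt ((Nat.factorial k : ℝ) / (Nat.factorial (m + k + m) : ℝ)) =
      (2 * m + k + 1) *
        Real.sqrt ((Nat.factorial (k + 1) : ℝ) / (Nat.factorial (m + k + 1 + m) : ℝ)) := by
  have h0 : (0 : ℝ) ≤ ((m + k : ℕ) + 1 : ℝ) ^ 2 - (m : ℝ) ^ 2 := by
    push_cast
    nlinarith [Nat.cast_nonneg (α := ℝ) m, Nat.cast_nonneg (α := ℝ) k]
  rw [← Real.sqrt_mul h0]
  rw [← Real.sqrt_sq (by positivity : (0 : ℝ) ≤ 2 * m + k + 1), ← Real.sqrt_mul (by positivity)]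
  congr 1
  rw [show m + k + 1 + m = m + k + m + 1 by ring, Nat.factorial_succ k,
    Nat.factorial_succ (m + k + m)]
  push_cast
  field_simp
  ring

theorem iteratedDeriv_legendreP_recurrence (m l : ℕ) (x : ℝ) :
    ((l : ℝ) + 2 - m) * iteratedDeriv m (legendreP (l + 2)) x =
      (2 * l + 3) * x * iteratedDeriv m (legendreP (l + 1)) x -
        (l + 1 + m) * iteratedDeriv m (legendreP l) x := by
  have h := congrArg (Polynomial.eval x) (rodrigues_recurrence m l)
  simp only [Polynomial.eval_mul, Polynomial.eval_add, Polynomial.eval_sub, Polynomial.eval_natCast,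
    Polynomial.eval_ofNat, Polynomial.eval_X, Polynomial.eval_one] at h
  simp only [iteratedDeriv_legendreP, Nat.factorial_succ]
  push_cast
  field_simp
  linear_combination 2 ^ l * 2 ^ (l + 1) * h

theorem pml_recurrence {m l : ℕ} (hl : m ≤ l) (x : ℝ) :
    Real.sqrt (((l : ℝ) + 1) ^ 2 - (m : ℝ) ^ 2) * pml m (l + 1) x =
      (2 * (l : ℝ) + 1) * x * pml m l x -
        Real.sqrt ((l : ℝ) ^ 2 - (m : ℝ) ^ 2) * pml m (l - 1) x := by
  have hsucc := sqrt_mul_sqrt_factorial_ratio_succ m (l - m)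
  rw [show m + (l - m) = l by omega, show l - m + 1 = l + 1 - m by omega] at hsucc
  rw [Nat.cast_sub hl] at hsucc
  rcases l with _ | n
  · obtain rfl : m = 0 := by omega
    have h0 (y : ℝ) : legendreP 0 y = 1 := by simp [legendreP]
    have h1 (y : ℝ) : legendreP 1 y = y := by
      simp [legendreP, iteratedDeriv_one]
    simp [pml, h0, h1]
  · have hrec := iteratedDeriv_legendreP_recurrence m n x
    have hpred : Real.sqrt (((n : ℝ) + 1) ^ 2 - (m : ℝ) ^ 2) * pml m n x =
        Real.sqrt ((Nat.factorial (n + 1 - m) : ℝ) / (Nat.factorial (n + 1 + m) : ℝ)) *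
          ((n + 1 + m) * iteratedDeriv m (legendreP n) x) := by
      rcases hl.eq_or_lt with h | h
      · have : iteratedDeriv m (legendreP n) x = 0 := by
          rw [iteratedDeriv_legendreP, rodrigues_eq_zero (by omega)]; simp
        simp [pml, this]
      · obtain ⟨k, rfl⟩ := Nat.exists_eq_add_of_le (Nat.lt_succ_iff.mp h)
        have := sqrt_mul_sqrt_factorial_ratio_pred m k
        rw [pml, Nat.add_sub_cancel_left, show m + k + 1 - m = k + 1 by omega]
        push_cast at this ⊢
        linear_combination iteratedDeriv m (legendreP (m + k)) x * this
    rw [Nat.add_sub_cancel]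
    rw [pml, pml]
    push_cast at *
    linear_combination iteratedDeriv m (legendreP (n + 1 + 1)) x * hsucc + hpred +
      Real.sqrt ((Nat.factorial (n + 1 - m) : ℝ) / (Nat.factorial (n + 1 + m) : ℝ)) * hrec

theorem doubleFactorial_two_mul_sub_one (m : ℕ) :
    (Nat.doubleFactorial (2 * m - 1) : ℝ) * (2 ^ m * (Nat.factorial m : ℝ)) =
      (Nat.factorial (2 * m) : ℝ) := by
  rcases m with _ | n
  · simp
  · have h := Nat.factorial_eq_mul_doubleFactorial (2 * n + 1)
    have h2 := Nat.doubleFactorial_two_mul (n + 1)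
    rw [show 2 * (n + 1) = 2 * n + 1 + 1 by ring] at h2 ⊢
    rw [h2] at h
    rw [h, Nat.add_sub_cancel]
    push_cast
    ring

theorem integral_pml_mul {m l : ℕ} (hl : m ≤ l) :
    (2 * (l : ℝ) + 1) * (1 / 2 * ∫ x in (-1 : ℝ)..1, pml m l x * (1 - x ^ 2) ^ m) =
      if l = m then
        Real.sqrt (Nat.factorial (2 * m)) / (Nat.doubleFactorial (2 * m - 1) : ℝ)
      else 0 := by
  simp only [pml_eq, mul_assoc, intervalIntegral.integral_const_mul]
  split_ifs with h
  · subst h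
    simp only [rodrigues_self, Polynomial.eval_C, intervalIntegral.integral_const_mul,
      integral_one_sub_sq_pow, Nat.sub_self, ← two_mul]
    rw [Nat.factorial_succ (2 * l), ← doubleFactorial_two_mul_sub_one l, Nat.factorial_zero,
      Nat.cast_one, Real.sqrt_div zero_le_one, Real.sqrt_one]
    have hd : (0 : ℝ) < (Nat.doubleFactorial (2 * l - 1) : ℝ) := by
      exact_mod_cast Nat.doubleFactorial_pos _
    have hs : Real.sqrt ((Nat.doubleFactorial (2 * l - 1) : ℝ) * (2 ^ l * (Nat.factorial l : ℝ))) ^ 2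
        = (Nat.doubleFactorial (2 * l - 1) : ℝ) * (2 ^ l * (Nat.factorial l : ℝ)) :=
      Real.sq_sqrt (by positivity)
    have hp : 0 < Real.sqrt
        ((Nat.doubleFactorial (2 * l - 1) : ℝ) * (2 ^ l * (Nat.factorial l : ℝ))) :=
      Real.sqrt_pos.mpr (by positivity)
    push_cast
    rw [← doubleFactorial_two_mul_sub_one l]
    generalize Real.sqrt _ = s at *
    field_simp
    linear_combination -hs
  · rw [integral_rodrigues_mul_eq_zero (by omega)]
    simp

/-- STATEMENT 4 (three-term recurrence for `q_l^m`), with the Kronecker-delta term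
`δ_{l,m} √((2m)!)/(2m−1)!!`. -/
theorem stmt_4 (m : ℕ) (l : ℕ) (hl : m ≤ l) (ν : ℝ) (hν : 1 < |ν|) :
    Real.sqrt (((l : ℝ) + 1) ^ 2 - (m : ℝ) ^ 2) * qml m (l + 1) ν =
      (2 * (l : ℝ) + 1) * ν * qml m l ν -
        Real.sqrt ((l : ℝ) ^ 2 - (m : ℝ) ^ 2) * qml m (l - 1) ν -
        (if l = m then
          Real.sqrt (Nat.factorial (2 * m)) / (Nat.doubleFactorial (2 * m - 1) : ℝ)
        else 0) := by
  have hne : ∀ x ∈ Set.uIcc (-1 : ℝ) 1, ν - x ≠ 0 := by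
    intro x hx h
    rw [Set.uIcc_of_le (by norm_num), Set.mem_Icc, ← abs_le] at hx
    rw [sub_eq_zero.mp h] at hν
    linarith
  have hint (k : ℕ) : IntervalIntegrable (fun x => pml m k x / (ν - x) * (1 - x ^ 2) ^ m)
      volume (-1) 1 :=
    (((continuous_pml m k).continuousOn.div (by fun_prop) hne).mul
      (by fun_prop)).intervalIntegrable
  have hint' : IntervalIntegrable (fun x => pml m l x * (1 - x ^ 2) ^ m) volume (-1) 1 :=
    ((continuous_pml m l).mul (by fun_prop)).intervalIntegrable _ _
  rw [← integral_pml_mul hl]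
  have key : ∫ x in (-1 : ℝ)..1, Real.sqrt (((l : ℝ) + 1) ^ 2 - (m : ℝ) ^ 2) *
        (pml m (l + 1) x / (ν - x) * (1 - x ^ 2) ^ m) =
      ∫ x in (-1 : ℝ)..1, ((2 * (l : ℝ) + 1) * ν * (pml m l x / (ν - x) * (1 - x ^ 2) ^ m) -
        Real.sqrt ((l : ℝ) ^ 2 - (m : ℝ) ^ 2) * (pml m (l - 1) x / (ν - x) * (1 - x ^ 2) ^ m) -
        (2 * (l : ℝ) + 1) * (pml m l x * (1 - x ^ 2) ^ m)) := by
    refine intervalIntegral.integral_congr fun x hx => ?_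
    have h1 := pml_recurrence hl x
    have h2 := hne x hx
    field_simp
    linear_combination (1 - x ^ 2) ^ m * h1
  rw [intervalIntegral.integral_sub (((hint l).const_mul _).sub ((hint (l - 1)).const_mul _))
    (hint'.const_mul _), intervalIntegral.integral_sub ((hint l).const_mul _)
    ((hint (l - 1)).const_mul _)] at key
  simp only [intervalIntegral.integral_const_mul] at key
  simp only [qml]
  linear_combination 1 / 2 * key
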